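/- Let d ≥ 1 and let A, B be continuous ℂ^{d×d}-valued functions on [-1,1]. Let Φ_A : [-1,1] → ℂ^{d×d} be differentiable with Φ_A'(t) = A(t)·Φ_A(t), Φ_A(−1) = I_d, and Φ_A(t) invertible for every t, and suppose |Φ_A(t)·Φ_A(s)^{-1}| ≤ C_A whenever −1 ≤ s ≤ t ≤ 1. Define the monodromy operator (𝐔f)(t) = Φ_A(t)·[f(1) + ∫_{-1}^t Φ_A(s)^{-1}·B(s)·f(s) ds] for continuous f : [-1,1] → ℂ^d. Set a = (1 + ‖A‖_∞²)^{1/2} and c = 0.9062. Then for every continuous f : [-1,1] → ℂ^d with ‖f‖_{𝐇¹} < ∞, one has ‖𝐔f‖_{𝐇¹} ≤ √(2πd)·( c·a·C_A + ‖B‖_∞·(c² + π·a²·C_A²/2)^{1/2} )·‖f‖_{𝐇¹}. -/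

import Mathlib

open Set

/-- The operator norm of a matrix induced by the Euclidean norm on `ℂ^d`. -/
noncomputable def matNorm {d : ℕ} (M : Matrix (Fin d) (Fin d) ℂ) : ℝ :=
  ‖LinearMap.toContinuousLinearMap (Matrix.toEuclideanLin M)‖

/-- The sup (over `[-1,1]`) of the operator norm of a matrix-valued function. -/
noncomputable def supNormMat {d : ℕ} (F : ℝ → Matrix (Fin d) (Fin d) ℂ) : ℝ :=
  ⨆ t : Set.Icc (-1 : ℝ) 1, matNorm (F t)

/-- The normalized Chebyshev polynomials. -/
noncomputable def That (k : ℕ) (t : ℝ) : ℝ :=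
  if k = 0 then Real.sqrt (1 / Real.pi)
  else Real.sqrt (2 / Real.pi) * Real.cos (k * Real.arccos t)

/-- The Chebyshev expansion coefficients of a scalar function. -/
noncomputable def chebCoeff (f : ℝ → ℂ) (k : ℕ) : ℂ :=
  ∫ t in (-1 : ℝ)..1, (That k t : ℂ) * f t * ((Real.sqrt (1 - t ^ 2) : ℝ) : ℂ)⁻¹

/-- The squared `𝐇¹` norm of a vector-valued function:
`‖f‖² = Σ_k (1+k)²·|f̂_k|²` where `|f̂_k|` is the Euclidean norm of the vector
of componentwise Chebyshev coefficients. -/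
noncomputable def h1NormVecSq {d : ℕ} (f : ℝ → Fin d → ℂ) : ℝ :=
  ∑' k : ℕ, ((1 : ℝ) + k) ^ 2 * ∑ i : Fin d, ‖chebCoeff (fun t => f t i) k‖ ^ 2

/-- The monodromy operator for the DDE system:
`(𝐔f)(t) = Φ_A(t)·[f(1) + ∫_{-1}^t Φ_A(s)⁻¹·B(s)·f(s) ds]` (integrals taken
componentwise). -/
noncomputable def UopVec {d : ℕ} (PhiA : ℝ → Matrix (Fin d) (Fin d) ℂ)
    (B : ℝ → Matrix (Fin d) (Fin d) ℂ) (f : ℝ → Fin d → ℂ) (t : ℝ) : Fin d → ℂ :=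
  (PhiA t).mulVec fun i =>
    f 1 i + ∫ s in (-1 : ℝ)..t, ((PhiA s)⁻¹.mulVec ((B s).mulVec (f s))) i

theorem sub_cos (f : ℝ → ℂ) :
    ∫ x in (-1:ℝ)..1, f x * ((Real.sqrt (1 - x ^ 2) : ℝ) : ℂ)⁻¹ = ∫ θ in (0:ℝ)..Real.pi, f (Real.cos θ) := by
  calc _ = ∫ x in (1:ℝ)..(-1), (-(1 / Real.sqrt (1 - x ^ 2))) • f x := by
        rw [intervalIntegral.integral_symm, ← intervalIntegral.integral_neg]
        congr 1; ext x
        rw [Complex.real_smul]; push_cast; ring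
    _ = ∫ θ in (Real.arccos 1)..(Real.arccos (-1)), f (Real.cos θ) := by
      rw [← intervalIntegral.integral_deriv_smul_comp_of_deriv_nonpos (f' := fun x => -(1 / Real.sqrt (1 - x ^ 2)))
        (f := Real.arccos) (g := fun θ => f (Real.cos θ))]
      · simp_rw [Function.comp_apply]
        exact intervalIntegral.integral_congr <| fun x hx => by
          simp [Real.cos_arccos (x := x) (by aesop) (by aesop)]
      · exact Real.continuous_arccos.continuousOn
      · exact fun x hx ↦ (Real.hasDerivAt_arccos (by aesop) (by aesop))
      · simp
    _ = _ := by simp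

noncomputable def FC (f : ℝ → ℂ) (n : ℤ) : ℂ :=
  fourierCoeffOn (neg_lt_self Real.pi_pos) (fun θ => f (Real.cos θ)) n

theorem FC_eq (f : ℝ → ℂ) (hf : ContinuousOn f (Icc (-1) 1)) (n : ℤ) :
    FC f n = (1 / Real.pi : ℝ) • ∫ θ in (0:ℝ)..Real.pi, (Real.cos (n * θ) : ℂ) * f (Real.cos θ) := by
  have hF : Continuous (fun θ : ℝ => f (Real.cos θ)) := by
    rw [← continuousOn_univ]
    exact hf.comp Real.continuous_cos.continuousOn (fun x _ => ⟨Real.neg_one_le_cos x, Real.cos_le_one x⟩)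
  have hpi := Real.pi_pos
  rw [FC, fourierCoeffOn_eq_integral]
  have h1 : ∀ θ : ℝ, (fourier (-n) (θ : AddCircle (Real.pi - -Real.pi)) : ℂ) • f (Real.cos θ)
      = Complex.exp (-(n * θ : ℝ) * Complex.I) * f (Real.cos θ) := by
    intro θ
    rw [fourier_coe_apply, smul_eq_mul]
    congr 2
    have : (Real.pi : ℂ) ≠ 0 := by exact_mod_cast hpi.ne'
    push_cast
    field_simp
    ring
  simp_rw [h1]
  have hc : ∀ s : ℝ, Continuous (fun θ : ℝ => Complex.exp (s * (n * θ : ℝ) * Complex.I) * f (Real.cos θ)) := by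
    intro s; exact Continuous.mul (by fun_prop) hF
  have h2 : ∫ θ in (-Real.pi)..0, Complex.exp (-(n * θ : ℝ) * Complex.I) * f (Real.cos θ)
      = ∫ θ in (0:ℝ)..Real.pi, Complex.exp ((n * θ : ℝ) * Complex.I) * f (Real.cos θ) := by
    have := intervalIntegral.integral_comp_neg (a := 0) (b := Real.pi)
      (fun θ : ℝ => Complex.exp (-(n * θ : ℝ) * Complex.I) * f (Real.cos θ))
    simpa using this.symm
  rw [← intervalIntegral.integral_add_adjacent_intervals (b := 0), h2,
    ← intervalIntegral.integral_add]
  · have : ∀ θ : ℝ, Complex.exp ((n * θ : ℝ) * Complex.I) * f (Real.cos θ) + Complex.exp (-(n * θ : ℝ) * Complex.I) * f (Real.cos θ) = (2:ℝ) • ((Real.cos (n * θ) : ℂ) * f (Real.cos θ)) := by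
      intro θ
      rw [Complex.real_smul, Complex.ofReal_cos, Complex.cos]
      push_cast; ring
    simp_rw [this]
    rw [intervalIntegral.integral_smul, smul_smul]
    congr 1
    field_simp; norm_num
  all_goals
    apply Continuous.intervalIntegrable
    first
    | simpa using hc 1
    | simpa using hc (-1)

theorem FC_neg (f : ℝ → ℂ) (hf : ContinuousOn f (Icc (-1) 1)) (n : ℤ) : FC f (-n) = FC f n := by
  rw [FC_eq f hf, FC_eq f hf]; simp

theorem cheb_FC (f : ℝ → ℂ) (hf : ContinuousOn f (Icc (-1) 1)) (k : ℕ) :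
    ‖chebCoeff f k‖ ^ 2 = (if k = 0 then Real.pi else 2 * Real.pi) * ‖FC f k‖ ^ 2 := by
  have hpi := Real.pi_pos
  rw [chebCoeff, sub_cos (fun t => (That k t : ℂ) * f t), FC_eq f hf]
  rcases eq_or_ne k 0 with rfl | hk
  · simp [That]
    rw [abs_of_pos hpi, mul_pow, mul_pow, inv_pow, sq_abs, Real.sq_sqrt hpi.le]
    field_simp
  · have : ∫ θ in (0:ℝ)..Real.pi, (That k (Real.cos θ) : ℂ) * f (Real.cos θ)
      = (Real.sqrt (2 / Real.pi)) • ∫ θ in (0:ℝ)..Real.pi, (Real.cos ((k:ℤ) * θ) : ℂ) * f (Real.cos θ) := by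
      rw [← intervalIntegral.integral_smul]
      apply intervalIntegral.integral_congr
      intro θ hθ
      rw [uIcc_of_le hpi.le] at hθ
      simp only [That, hk, if_false, Complex.real_smul]
      rw [Real.arccos_cos hθ.1 hθ.2]
      push_cast; ring
    rw [this]
    simp only [hk, if_false, norm_smul, mul_pow, Real.norm_eq_abs, sq_abs]
    rw [Real.sq_sqrt (by positivity)]
    field_simp

theorem hasSum_cheb (f : ℝ → ℂ) (hf : ContinuousOn f (Icc (-1) 1)) (w : ℕ → ℝ) (S : ℝ) :
    HasSum (fun n : ℤ => w n.natAbs * ‖FC f n‖ ^ 2) S →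
    HasSum (fun k : ℕ => w k * ‖chebCoeff f k‖ ^ 2) (Real.pi * S) := by
  intro h
  have h1 := (h.nat_add_neg).sub (hasSum_ite_eq (0:ℕ) (w 0 * ‖FC f 0‖ ^ 2))
  convert! h1.mul_left Real.pi using 1
  · ext k
    rw [cheb_FC f hf]
    rcases eq_or_ne k 0 with rfl | hk
    · simp; ring
    · simp [hk, FC_neg f hf]; ring
  · simp

theorem summable_cheb (f : ℝ → ℂ) (hf : ContinuousOn f (Icc (-1) 1)) (w : ℕ → ℝ) 
    (h : Summable (fun k : ℕ => w k * ‖chebCoeff f k‖ ^ 2)) :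
    Summable (fun n : ℤ => w n.natAbs * ‖FC f n‖ ^ 2) := by
  have hpi := Real.pi_pos
  have key : Summable (fun k : ℕ => w k * ‖FC f k‖ ^ 2) := by
    rw [← summable_nat_add_iff 1] at h ⊢
    refine (h.mul_left (2 * Real.pi)⁻¹).congr fun k => ?_
    rw [cheb_FC f hf]
    simp only [Nat.add_eq_zero_iff, one_ne_zero, and_false, if_false]
    field_simp
  apply Summable.of_nat_of_neg
  · simpa using key
  · simpa [FC_neg f hf] using key
theorem cont_cos {E : Type*} [TopologicalSpace E] {f : ℝ → E} (hf : ContinuousOn f (Icc (-1) 1)) :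
    Continuous (fun θ : ℝ => f (Real.cos θ)) := by
  rw [← continuousOn_univ]
  exact hf.comp Real.continuous_cos.continuousOn
    (fun x _ => ⟨Real.neg_one_le_cos x, Real.cos_le_one x⟩)

theorem parseval_cont (F : ℝ → ℂ) (hF : Continuous F) :
    HasSum (fun n => ‖fourierCoeffOn (neg_lt_self Real.pi_pos) F n‖ ^ 2)
      ((2 * Real.pi)⁻¹ * ∫ x in (-Real.pi)..Real.pi, ‖F x‖ ^ 2) := by
  have := hasSum_sq_fourierCoeffOn (f := F) (neg_lt_self Real.pi_pos) ?_
  · convert! this using 1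
    rw [smul_eq_mul]; congr 2; ring
  · rw [MeasureTheory.memLp_two_iff_integrable_sq_norm hF.aestronglyMeasurable]
    have h := (hF.norm.pow 2).intervalIntegrable (μ := MeasureTheory.volume) (-Real.pi) Real.pi
    rw [intervalIntegrable_iff, uIoc_of_le (neg_le_self Real.pi_pos.le)] at h
    exact h

theorem FC_deriv (g g' : ℝ → ℂ) (hg : ∀ t ∈ Icc (-1:ℝ) 1, HasDerivWithinAt g (g' t) (Icc (-1) 1) t)
    (hg' : ContinuousOn g' (Icc (-1) 1)) (n : ℤ) (hn : n ≠ 0) :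
    ‖fourierCoeffOn (neg_lt_self Real.pi_pos) (fun θ => -(Real.sin θ : ℂ) * g' (Real.cos θ)) n‖ ^ 2
      = (n : ℝ) ^ 2 * ‖FC g n‖ ^ 2 := by
  have hpi := Real.pi_pos
  have hc : Continuous (fun θ : ℝ => -(Real.sin θ : ℂ) * g' (Real.cos θ)) :=
    Continuous.mul (by fun_prop) (cont_cos hg')
  have hd : ∀ θ : ℝ, HasDerivAt (fun θ : ℝ => g (Real.cos θ)) (-(Real.sin θ : ℂ) * g' (Real.cos θ)) θ := by
    intro θ
    have := HasDerivWithinAt.scomp (t' := Icc (-1:ℝ) 1) (s := univ) θ (hg (Real.cos θ) ⟨Real.neg_one_le_cos θ, Real.cos_le_one θ⟩)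
      (Real.hasDerivAt_cos θ).hasDerivWithinAt (fun x _ => ⟨Real.neg_one_le_cos x, Real.cos_le_one x⟩)
    rw [hasDerivWithinAt_univ] at this
    simpa [Function.comp_def] using this
  have h := fourierCoeffOn_of_hasDerivAt (neg_lt_self Real.pi_pos) hn (fun x _ => hd x) (hc.intervalIntegrable _ _)
  rw [FC, h]
  simp only [Real.cos_neg, sub_self, mul_zero, zero_sub]
  rw [norm_mul, norm_neg, norm_mul, mul_pow, mul_pow]
  have h1 : ‖((Real.pi : ℂ) - (-Real.pi : ℝ))‖ = 2 * Real.pi := by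
    rw [show ((Real.pi : ℂ) - (-Real.pi : ℝ)) = ((2 * Real.pi : ℝ) : ℂ) by push_cast; ring, Complex.norm_real, Real.norm_of_nonneg (by positivity)]
  rw [h1]
  have hn' : (n : ℝ) ≠ 0 := by exact_mod_cast hn
  simp [abs_of_pos hpi]
  field_simp
  rw [sq_abs]

theorem h1_upper (g g' : ℝ → ℂ) (hg : ∀ t ∈ Icc (-1:ℝ) 1, HasDerivWithinAt g (g' t) (Icc (-1) 1) t)
    (hg' : ContinuousOn g' (Icc (-1) 1)) :
    Summable (fun k : ℕ => ((1 : ℝ) + k) ^ 2 * ‖chebCoeff g k‖ ^ 2) ∧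
    ∑' k : ℕ, ((1 : ℝ) + k) ^ 2 * ‖chebCoeff g k‖ ^ 2 ≤
      ∫ θ in (-Real.pi)..Real.pi, (‖g (Real.cos θ)‖ ^ 2 + Real.sin θ ^ 2 * ‖g' (Real.cos θ)‖ ^ 2) := by
  have hpi := Real.pi_pos
  have hgc : ContinuousOn g (Icc (-1) 1) := fun t ht => (hg t ht).continuousWithinAt
  have hG := cont_cos hgc
  have hG' : Continuous (fun θ : ℝ => -(Real.sin θ : ℂ) * g' (Real.cos θ)) :=
    Continuous.mul (by fun_prop) (cont_cos hg')
  have s := ((parseval_cont _ hG).add (parseval_cont _ hG')).mul_left 2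
  have hle : ∀ n : ℤ, ((1:ℝ) + n.natAbs) ^ 2 * ‖FC g n‖ ^ 2 ≤ 2 * (‖fourierCoeffOn (neg_lt_self Real.pi_pos) (fun θ => g (Real.cos θ)) n‖ ^ 2 + ‖fourierCoeffOn (neg_lt_self Real.pi_pos) (fun θ => -(Real.sin θ : ℂ) * g' (Real.cos θ)) n‖ ^ 2) := by
    intro n
    change _ ≤ 2 * (‖FC g n‖ ^ 2 + _)
    rcases eq_or_ne n 0 with rfl | hn
    · simp; nlinarith [sq_nonneg ‖FC g 0‖, sq_nonneg ‖fourierCoeffOn (neg_lt_self Real.pi_pos) (fun θ => -(Complex.sin θ) * g' (Real.cos θ)) 0‖]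
    · rw [FC_deriv g g' hg hg' n hn]
      have : (n:ℝ)^2 = (n.natAbs : ℝ)^2 := by rw [Nat.cast_natAbs]; simp
      rw [this]
      nlinarith [sq_nonneg ‖FC g n‖, mul_nonneg (sq_nonneg ‖FC g n‖) (sq_nonneg ((n.natAbs:ℝ) - 1))]
  have hs : Summable (fun n : ℤ => ((1:ℝ) + n.natAbs) ^ 2 * ‖FC g n‖ ^ 2) :=
    Summable.of_nonneg_of_le (fun n => by positivity) hle s.summable
  have hk := hasSum_cheb g hgc (fun k => ((1:ℝ) + k) ^ 2) _ hs.hasSum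
  refine ⟨hk.summable, ?_⟩
  rw [hk.tsum_eq]
  have := hs.tsum_le_tsum hle s.summable
  rw [s.tsum_eq, ← mul_add, ← intervalIntegral.integral_add] at this
  · calc _ ≤ _ := mul_le_mul_of_nonneg_left this hpi.le
      _ = _ := by
        rw [← mul_assoc, ← mul_assoc, show Real.pi * 2 * (2 * Real.pi)⁻¹ = 1 by field_simp, one_mul]
        congr 1; ext θ
        rw [norm_mul, norm_neg, Complex.norm_real, mul_pow, Real.norm_eq_abs, sq_abs]
  · exact (hG.norm.pow 2).intervalIntegrable _ _
  · exact (hG'.norm.pow 2).intervalIntegrable _ _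

theorem wsum : Summable (fun n : ℤ => (((1:ℝ) + n.natAbs) ^ 2)⁻¹) ∧
    ∑' n : ℤ, (((1:ℝ) + n.natAbs) ^ 2)⁻¹ = Real.pi ^ 2 / 3 - 1 := by
  have h : HasSum (fun n : ℕ => (((1:ℝ) + n) ^ 2)⁻¹) (Real.pi ^ 2 / 6) := by
    have := (hasSum_nat_add_iff' 1).2 hasSum_zeta_two
    simp at this
    simpa [add_comm] using this
  have := HasSum.of_nat_of_neg (f := fun n : ℤ => (((1:ℝ) + n.natAbs) ^ 2)⁻¹) (by simpa using h) (by simpa using h)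
  refine ⟨this.summable, ?_⟩
  rw [this.tsum_eq]; simp; ring

theorem l2_f (f : ℝ → ℂ) (hf : ContinuousOn f (Icc (-1) 1))
    (hs : Summable (fun k : ℕ => ((1 : ℝ) + k) ^ 2 * ‖chebCoeff f k‖ ^ 2)) :
    ∫ θ in (-Real.pi)..Real.pi, ‖f (Real.cos θ)‖ ^ 2 ≤
      2 * ∑' k : ℕ, ((1 : ℝ) + k) ^ 2 * ‖chebCoeff f k‖ ^ 2 := by
  have hpi := Real.pi_pos
  have h := parseval_cont _ (cont_cos hf)
  have h1 := hasSum_cheb f hf (fun _ => 1) _ (by simp only [one_mul]; exact h)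
  have h2 := h1.summable.tsum_le_tsum (g := fun k : ℕ => ((1 : ℝ) + k) ^ 2 * ‖chebCoeff f k‖ ^ 2)
    (fun k => mul_le_mul_of_nonneg_right (by nlinarith [(Nat.cast_nonneg k : (0:ℝ) ≤ k)]) (by positivity)) hs
  rw [h1.tsum_eq] at h2
  have e : Real.pi * ((2 * Real.pi)⁻¹ * ∫ θ in (-Real.pi)..Real.pi, ‖f (Real.cos θ)‖ ^ 2) = (∫ θ in (-Real.pi)..Real.pi, ‖f (Real.cos θ)‖ ^ 2) / 2 := by
    field_simp
  rw [e] at h2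
  linarith

theorem norm_le_FC (f : ℝ → ℂ) (hf : ContinuousOn f (Icc (-1) 1))
    (hsum : Summable (fun n => ‖FC f n‖)) (t : ℝ) (ht : t ∈ Icc (-1:ℝ) 1) :
    ‖f t‖ ≤ ∑' n, ‖FC f n‖ := by
  have hpi := Real.pi_pos
  have hF : Fact (0 < Real.pi - -Real.pi) := ⟨by linarith⟩
  have hper : (fun θ : ℝ => f (Real.cos θ)) (-Real.pi) = (fun θ : ℝ => f (Real.cos θ)) (-Real.pi + (Real.pi - -Real.pi)) := by
    simp
  have hcont := AddCircle.liftIoc_continuous hper (cont_cos hf).continuousOn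
  obtain ⟨Fc, hFc0⟩ : ∃ Fc : C(AddCircle (Real.pi - -Real.pi), ℂ), ⇑Fc = AddCircle.liftIoc (Real.pi - -Real.pi) (-Real.pi) (fun θ : ℝ => f (Real.cos θ)) := ⟨⟨_, hcont⟩, rfl⟩
  have hFc : ∀ n, fourierCoeff Fc n = FC f n := fun n => by
    rw [hFc0, FC, fourierCoeffOn]
  have hsn : Summable (fourierCoeff Fc) := Summable.of_norm (by simpa only [hFc] using hsum)
  have hp := has_pointwise_sum_fourier_series_of_summable hsn ((Real.arccos t : ℝ) : AddCircle _)
  have hv : Fc ((Real.arccos t : ℝ) : AddCircle _) = f t := by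
    rw [hFc0, AddCircle.liftIoc_coe_apply]
    · rw [Real.cos_arccos ht.1 ht.2]
    · rw [add_sub_cancel]
      constructor
      · linarith [Real.arccos_nonneg t]
      · exact Real.arccos_le_pi t
  rw [hv] at hp
  rw [← hp.tsum_eq]
  refine tsum_of_norm_bounded hsum.hasSum fun n => ?_
  rw [norm_smul, hFc]
  have : ‖(fourier n ((Real.arccos t : ℝ) : AddCircle (Real.pi - -Real.pi)) : ℂ)‖ = 1 := by
    rw [fourier_apply]; exact Circle.norm_coe _
  rw [this, mul_one]

theorem cs_FC (u : ℤ → ℝ) (hu : ∀ n, 0 ≤ u n) (S : ℝ)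
    (hZ : HasSum (fun n : ℤ => ((1:ℝ) + n.natAbs) ^ 2 * u n ^ 2) S) :
    Summable u ∧ (∑' n, u n) ^ 2 ≤ (Real.pi ^ 2 / 3 - 1) * S := by
  have hS0 : 0 ≤ S := hZ.nonneg fun n => by positivity
  have hw : 0 ≤ Real.pi ^ 2 / 3 - 1 := by nlinarith [Real.pi_gt_three]
  have cs := Real.summable_and_inner_le_Lp_mul_Lq_tsum_of_nonneg (p := 2) (q := 2) Real.HolderConjugate.two_two
    (f := fun n : ℤ => ((1:ℝ) + n.natAbs)⁻¹) (g := fun n : ℤ => ((1:ℝ) + n.natAbs) * u n)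
    (fun n => by positivity) (fun n => mul_nonneg (by positivity) (hu n))
    (by simpa only [Real.rpow_two, inv_pow] using wsum.1)
    (by simpa only [Real.rpow_two, mul_pow] using hZ.summable)
  have e : ∀ n : ℤ, ((1:ℝ) + n.natAbs)⁻¹ * (((1:ℝ) + n.natAbs) * u n) = u n := by
    intro n
    have : (1:ℝ) + n.natAbs ≠ 0 := by positivity
    field_simp
  simp only [e, Real.rpow_two, mul_pow, inv_pow, wsum.2, hZ.tsum_eq] at cs
  obtain ⟨hsum, hle⟩ := cs
  refine ⟨hsum, ?_⟩
  have h0 : 0 ≤ ∑' n, u n := tsum_nonneg hu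
  calc (∑' n, u n) ^ 2 ≤ ((Real.pi ^ 2 / 3 - 1) ^ (1 / (2:ℝ)) * S ^ (1 / (2:ℝ))) ^ 2 := by
        gcongr
    _ = (Real.pi ^ 2 / 3 - 1) * S := by
        rw [mul_pow, ← Real.sqrt_eq_rpow, ← Real.sqrt_eq_rpow, Real.sq_sqrt hw, Real.sq_sqrt hS0]

theorem sup_f (f : ℝ → ℂ) (hf : ContinuousOn f (Icc (-1) 1))
    (hs : Summable (fun k : ℕ => ((1 : ℝ) + k) ^ 2 * ‖chebCoeff f k‖ ^ 2)) (t : ℝ)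
    (ht : t ∈ Icc (-1:ℝ) 1) :
    ‖f t‖ ^ 2 ≤ 0.9062 ^ 2 * ∑' k : ℕ, ((1 : ℝ) + k) ^ 2 * ‖chebCoeff f k‖ ^ 2 := by
  have hpi := Real.pi_pos
  have hZ := summable_cheb f hf (fun k => ((1:ℝ) + k) ^ 2) hs
  have hS := hZ.hasSum
  have hT := hasSum_cheb f hf (fun k => ((1:ℝ) + k) ^ 2) _ hS
  rw [hT.tsum_eq]
  have hS0 : 0 ≤ ∑' n : ℤ, ((1:ℝ) + n.natAbs) ^ 2 * ‖FC f n‖ ^ 2 := tsum_nonneg fun n => by positivity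
  obtain ⟨h1, h2⟩ := cs_FC (fun n => ‖FC f n‖) (fun n => norm_nonneg _) _ hS
  have hb := norm_le_FC f hf h1 t ht
  calc ‖f t‖ ^ 2 ≤ (∑' n, ‖FC f n‖) ^ 2 := by gcongr
    _ ≤ _ := h2
    _ ≤ (0.9062 ^ 2 * Real.pi) * _ := by
        refine mul_le_mul_of_nonneg_right ?_ hS0
        nlinarith [Real.pi_gt_three, Real.pi_lt_d2]
    _ = _ := by ring

theorem l2_half (f : ℝ → ℂ) (hf : ContinuousOn f (Icc (-1) 1))
    (hs : Summable (fun k : ℕ => ((1 : ℝ) + k) ^ 2 * ‖chebCoeff f k‖ ^ 2)) :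
    ∫ θ in (0:ℝ)..Real.pi, ‖f (Real.cos θ)‖ ^ 2 ≤
      ∑' k : ℕ, ((1 : ℝ) + k) ^ 2 * ‖chebCoeff f k‖ ^ 2 := by
  have h := l2_f f hf hs
  have hc : Continuous (fun θ : ℝ => ‖f (Real.cos θ)‖ ^ 2) := ((cont_cos hf).norm.pow 2)
  have := intervalIntegral.integral_comp_neg (a := 0) (b := Real.pi)
      (fun θ : ℝ => ‖f (Real.cos θ)‖ ^ 2)
  simp only [Real.cos_neg, neg_zero] at this
  rw [← intervalIntegral.integral_add_adjacent_intervals (b := 0) (hc.intervalIntegrable _ _) (hc.intervalIntegrable _ _), ← this] at h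
  linarith

noncomputable def vn {d : ℕ} (v : Fin d → ℂ) : ℝ := ‖(WithLp.toLp 2 v : EuclideanSpace ℂ (Fin d))‖

theorem vn_nonneg {d : ℕ} (v : Fin d → ℂ) : 0 ≤ vn v := norm_nonneg _

theorem vn_sq {d : ℕ} (v : Fin d → ℂ) : vn v ^ 2 = ∑ i, ‖v i‖ ^ 2 := by
  rw [vn, EuclideanSpace.norm_sq_eq]

theorem vn_add {d : ℕ} (v w : Fin d → ℂ) : vn (v + w) ≤ vn v + vn w := by
  rw [vn, WithLp.toLp_add]; exact norm_add_le _ _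

theorem vn_mulVec {d : ℕ} (M : Matrix (Fin d) (Fin d) ℂ) (v : Fin d → ℂ) :
    vn (M.mulVec v) ≤ matNorm M * vn v :=
  (LinearMap.toContinuousLinearMap (Matrix.toEuclideanLin M)).le_opNorm (WithLp.toLp 2 v)

theorem matNorm_nonneg {d : ℕ} (M : Matrix (Fin d) (Fin d) ℂ) : 0 ≤ matNorm M := norm_nonneg _

theorem contOn_toLp {d : ℕ} {f : ℝ → Fin d → ℂ} {s : Set ℝ}
    (hf : ∀ i : Fin d, ContinuousOn (fun t => f t i) s) :
    ContinuousOn (fun t => (WithLp.toLp 2 (f t) : EuclideanSpace ℂ (Fin d))) s :=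
  (PiLp.continuous_toLp 2 _).comp_continuousOn (continuousOn_pi.2 hf)

theorem contOn_vn {d : ℕ} {f : ℝ → Fin d → ℂ} {s : Set ℝ}
    (hf : ∀ i : Fin d, ContinuousOn (fun t => f t i) s) :
    ContinuousOn (fun t => vn (f t)) s := (contOn_toLp hf).norm

theorem contOn_mulVec {d : ℕ} {M : ℝ → Matrix (Fin d) (Fin d) ℂ} {f : ℝ → Fin d → ℂ} {s : Set ℝ}
    (hM : ∀ i j : Fin d, ContinuousOn (fun t => M t i j) s)
    (hf : ∀ i : Fin d, ContinuousOn (fun t => f t i) s) (i : Fin d) :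
    ContinuousOn (fun t => (M t).mulVec (f t) i) s := by
  simp only [Matrix.mulVec, dotProduct]
  exact continuousOn_finsetSum _ fun j _ => (hM i j).mul (hf j)

theorem contOn_mat {d : ℕ} {M : ℝ → Matrix (Fin d) (Fin d) ℂ} {s : Set ℝ}
    (hM : ∀ i j : Fin d, ContinuousOn (fun t => M t i j) s) : ContinuousOn M s :=
  continuousOn_pi.2 fun i => continuousOn_pi.2 fun j => hM i j

theorem contOn_inv {d : ℕ} {M : ℝ → Matrix (Fin d) (Fin d) ℂ} {s : Set ℝ}
    (hM : ∀ i j : Fin d, ContinuousOn (fun t => M t i j) s) (hu : ∀ t ∈ s, IsUnit (M t))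
    (i j : Fin d) : ContinuousOn (fun t => (M t)⁻¹ i j) s := by
  have h := contOn_mat hM
  have hdet : ContinuousOn (fun t => (M t).det) s := (continuous_id.matrix_det).comp_continuousOn h
  have hadj : ContinuousOn (fun t => (M t).adjugate) s :=
    (continuous_id.matrix_adjugate).comp_continuousOn h
  have hij : ContinuousOn (fun t => (M t).adjugate i j) s :=
    continuousOn_pi.1 (continuousOn_pi.1 hadj i) j
  have hne : ∀ t ∈ s, (M t).det ≠ 0 := fun t ht =>
    ((Matrix.isUnit_iff_isUnit_det _).1 (hu t ht)).ne_zero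
  refine ((hdet.inv₀ hne).mul hij).congr fun t ht => ?_
  simp [Matrix.inv_def]

theorem matNorm_le_sup {d : ℕ} {F : ℝ → Matrix (Fin d) (Fin d) ℂ}
    (hF : ∀ i j : Fin d, ContinuousOn (fun t => F t i j) (Icc (-1:ℝ) 1)) {t : ℝ}
    (ht : t ∈ Icc (-1:ℝ) 1) : matNorm (F t) ≤ supNormMat F := by
  have hc : ContinuousOn (fun t => matNorm (F t)) (Icc (-1:ℝ) 1) := by
    have h1 : Continuous (fun M : Matrix (Fin d) (Fin d) ℂ =>
        LinearMap.toContinuousLinearMap (Matrix.toEuclideanLin M)) :=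
      LinearMap.continuous_of_finiteDimensional
        ((Matrix.toEuclideanLin ≪≫ₗ LinearMap.toContinuousLinearMap :
          Matrix (Fin d) (Fin d) ℂ ≃ₗ[ℂ]
            (EuclideanSpace ℂ (Fin d) →L[ℂ] EuclideanSpace ℂ (Fin d))) :
          Matrix (Fin d) (Fin d) ℂ →ₗ[ℂ]
            (EuclideanSpace ℂ (Fin d) →L[ℂ] EuclideanSpace ℂ (Fin d)))
    exact (h1.comp_continuousOn (contOn_mat hF)).norm
  have hb := isCompact_Icc.bddAbove_image hc
  rw [image_eq_range] at hb
  exact le_ciSup (f := fun t : Set.Icc (-1 : ℝ) 1 => matNorm (F t)) hb ⟨t, ht⟩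

theorem supNormMat_nonneg {d : ℕ} (F : ℝ → Matrix (Fin d) (Fin d) ℂ) : 0 ≤ supNormMat F :=
  Real.iSup_nonneg fun _ => matNorm_nonneg _

theorem summable_comp {d : ℕ} {f : ℝ → Fin d → ℂ}
    (hs : Summable (fun k : ℕ => ((1 : ℝ) + k) ^ 2 * ∑ i : Fin d, ‖chebCoeff (fun t => f t i) k‖ ^ 2))
    (i : Fin d) :
    Summable (fun k : ℕ => ((1 : ℝ) + k) ^ 2 * ‖chebCoeff (fun t => f t i) k‖ ^ 2) := by
  refine Summable.of_nonneg_of_le (fun k => by positivity) (fun k => ?_) hs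
  gcongr
  exact Finset.single_le_sum (f := fun i => ‖chebCoeff (fun t => f t i) k‖ ^ 2)
    (fun i _ => by positivity) (Finset.mem_univ i)

theorem hasSum_vec {d : ℕ} {f : ℝ → Fin d → ℂ}
    (hs : ∀ i, Summable (fun k : ℕ => ((1 : ℝ) + k) ^ 2 * ‖chebCoeff (fun t => f t i) k‖ ^ 2)) :
    HasSum (fun k : ℕ => ((1 : ℝ) + k) ^ 2 * ∑ i : Fin d, ‖chebCoeff (fun t => f t i) k‖ ^ 2)
     (∑ i, ∑' k : ℕ, ((1 : ℝ) + k) ^ 2 * ‖chebCoeff (fun t => f t i) k‖ ^ 2) := by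
  simp_rw [Finset.mul_sum]
  exact hasSum_sum fun i _ => (hs i).hasSum

theorem h1_nonneg {d : ℕ} (f : ℝ → Fin d → ℂ) : 0 ≤ h1NormVecSq f :=
  tsum_nonneg fun k => by positivity

theorem sup_vec {d : ℕ} {f : ℝ → Fin d → ℂ}
    (hf : ∀ i : Fin d, ContinuousOn (fun t => f t i) (Icc (-1 : ℝ) 1))
    (hs : Summable (fun k : ℕ => ((1 : ℝ) + k) ^ 2 * ∑ i : Fin d, ‖chebCoeff (fun t => f t i) k‖ ^ 2))
    {t : ℝ} (ht : t ∈ Icc (-1:ℝ) 1) : vn (f t) ≤ 0.9062 * Real.sqrt (h1NormVecSq f) := by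
  refine (pow_le_pow_iff_left₀ (vn_nonneg _) (by positivity) two_ne_zero).1 ?_
  rw [mul_pow, Real.sq_sqrt (h1_nonneg f), vn_sq, h1NormVecSq,
    (hasSum_vec (summable_comp hs)).tsum_eq, Finset.mul_sum]
  exact Finset.sum_le_sum fun i _ => sup_f _ (hf i) (summable_comp hs i) t ht

theorem l2_vec {d : ℕ} {f : ℝ → Fin d → ℂ}
    (hf : ∀ i : Fin d, ContinuousOn (fun t => f t i) (Icc (-1 : ℝ) 1))
    (hs : Summable (fun k : ℕ => ((1 : ℝ) + k) ^ 2 * ∑ i : Fin d, ‖chebCoeff (fun t => f t i) k‖ ^ 2)) :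
    ∫ θ in (0:ℝ)..Real.pi, vn (f (Real.cos θ)) ^ 2 ≤ h1NormVecSq f := by
  simp_rw [vn_sq]
  rw [intervalIntegral.integral_finsetSum, h1NormVecSq, (hasSum_vec (summable_comp hs)).tsum_eq]
  · exact Finset.sum_le_sum fun i _ => l2_half _ (hf i) (summable_comp hs i)
  · exact fun i _ => ((cont_cos (hf i)).norm.pow 2).intervalIntegrable _ _

theorem l1_vec {d : ℕ} {f : ℝ → Fin d → ℂ}
    (hf : ∀ i : Fin d, ContinuousOn (fun t => f t i) (Icc (-1 : ℝ) 1))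
    (hs : Summable (fun k : ℕ => ((1 : ℝ) + k) ^ 2 * ∑ i : Fin d, ‖chebCoeff (fun t => f t i) k‖ ^ 2)) :
    ∫ s in (-1:ℝ)..1, vn (f s) ≤ Real.sqrt (Real.pi / 2) * Real.sqrt (h1NormVecSq f) := by
  have hpi := Real.pi_pos
  have hv : Continuous (fun θ : ℝ => vn (f (Real.cos θ))) := cont_cos (contOn_vn hf)
  have e : ∫ s in (-1:ℝ)..1, vn (f s) = ∫ θ in (0:ℝ)..Real.pi, vn (f (Real.cos θ)) * Real.sin θ := by
    have := intervalIntegral.integral_comp_mul_deriv_of_deriv_nonpos (a := 0) (b := Real.pi)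
      (f := Real.cos) (f' := fun θ => - Real.sin θ) (g := fun s => vn (f s))
      Real.continuous_cos.continuousOn (fun x _ => Real.hasDerivAt_cos x)
      (fun x hx => by
        rw [min_eq_left hpi.le, max_eq_right hpi.le] at hx
        linarith [Real.sin_pos_of_pos_of_lt_pi hx.1 hx.2])
    simp only [Real.cos_zero, Real.cos_pi, Function.comp_apply, mul_neg, intervalIntegral.integral_neg] at this
    rw [intervalIntegral.integral_symm, ← this, neg_neg]
  set I := ∫ s in (-1:ℝ)..1, vn (f s) with hI
  have h2 := l2_vec hf hs
  set E := ∫ θ in (0:ℝ)..Real.pi, vn (f (Real.cos θ)) ^ 2 with hE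
  have hsin : ∫ θ in (0:ℝ)..Real.pi, Real.sin θ ^ 2 = Real.pi / 2 := by
    rw [integral_sin_sq]; simp
  have hq : ∀ x : ℝ, 0 ≤ E * (x * x) + (-2 * I) * x + Real.pi / 2 := by
    intro x
    have h0 : 0 ≤ ∫ θ in (0:ℝ)..Real.pi, (vn (f (Real.cos θ)) * x - Real.sin θ) ^ 2 :=
      intervalIntegral.integral_nonneg hpi.le fun θ _ => sq_nonneg _
    have h1 : ∀ θ : ℝ, (vn (f (Real.cos θ)) * x - Real.sin θ) ^ 2 =
      (vn (f (Real.cos θ)) ^ 2 * (x * x) + (vn (f (Real.cos θ)) * Real.sin θ) * (-2 * x)) + Real.sin θ ^ 2 := fun θ => by ring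
    simp_rw [h1] at h0
    rw [intervalIntegral.integral_add, intervalIntegral.integral_add, intervalIntegral.integral_mul_const,
      intervalIntegral.integral_mul_const, hsin, ← e, ← hE] at h0
    · linarith
    all_goals apply Continuous.intervalIntegrable; fun_prop
  have hd := discrim_le_zero hq
  rw [discrim] at hd
  rw [← Real.sqrt_mul (by positivity)]
  apply Real.le_sqrt_of_sq_le
  nlinarith

section main
variable {d : ℕ} {A B PhiA : ℝ → Matrix (Fin d) (Fin d) ℂ}

theorem U_deriv
    (hPhiA : ∀ t ∈ Icc (-1 : ℝ) 1, ∀ i j : Fin d,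
      HasDerivWithinAt (fun t' => PhiA t' i j) ((A t * PhiA t) i j) (Icc (-1 : ℝ) 1) t)
    (hPhiAinv : ∀ t ∈ Icc (-1 : ℝ) 1, IsUnit (PhiA t))
    (hB : ∀ i j : Fin d, ContinuousOn (fun t => B t i j) (Icc (-1 : ℝ) 1))
    {f : ℝ → Fin d → ℂ} (hf : ∀ i : Fin d, ContinuousOn (fun t => f t i) (Icc (-1 : ℝ) 1))
    {t : ℝ} (ht : t ∈ Icc (-1:ℝ) 1) (i : Fin d) :
    HasDerivWithinAt (fun t => UopVec PhiA B f t i)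
      (((A t).mulVec (UopVec PhiA B f t) + (B t).mulVec (f t)) i) (Icc (-1) 1) t := by
  have hPc : ∀ i j : Fin d, ContinuousOn (fun t => PhiA t i j) (Icc (-1 : ℝ) 1) :=
    fun i j t ht => (hPhiA t ht i j).continuousWithinAt
  have hh : ∀ j, ContinuousOn (fun s => ((PhiA s)⁻¹.mulVec ((B s).mulVec (f s))) j) (Icc (-1:ℝ) 1) :=
    contOn_mulVec (contOn_inv hPc hPhiAinv) (contOn_mulVec hB hf)
  have hw : ∀ j, HasDerivWithinAt (fun t => f 1 j + ∫ s in (-1 : ℝ)..t, ((PhiA s)⁻¹.mulVec ((B s).mulVec (f s))) j)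
      (((PhiA t)⁻¹.mulVec ((B t).mulVec (f t))) j) (Icc (-1) 1) t := by
    intro j
    have : Fact (t ∈ Icc (-1:ℝ) 1) := ⟨ht⟩
    refine HasDerivWithinAt.const_add _ ?_
    refine intervalIntegral.integral_hasDerivWithinAt_right (t := Icc (-1) 1) ?_ ?_ (hh j t ht)
    · refine ((hh j).mono ?_).intervalIntegrable
      rw [uIcc_of_le ht.1]
      exact Icc_subset_Icc_right ht.2
    · exact (hh j).stronglyMeasurableAtFilter_nhdsWithin measurableSet_Icc t
  have hs := HasDerivWithinAt.fun_sum (u := Finset.univ) fun j _ => (hPhiA t ht i j).mul (hw j)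
  convert! hs using 1
  rw [Finset.sum_add_distrib]
  simp only [Pi.add_apply]
  congr 1
  · simp only [UopVec]
    rw [Matrix.mulVec_mulVec]
    rfl
  · have : (B t).mulVec (f t) = (PhiA t).mulVec ((PhiA t)⁻¹.mulVec ((B t).mulVec (f t))) := by
      rw [Matrix.mulVec_mulVec, Matrix.mul_nonsing_inv _ ((Matrix.isUnit_iff_isUnit_det _).1 (hPhiAinv t ht)),
        Matrix.one_mulVec]
    rw [this, Matrix.mulVec, dotProduct]
    rw [← this]

theorem U_bound
    (hPhiA : ∀ t ∈ Icc (-1 : ℝ) 1, ∀ i j : Fin d,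
      HasDerivWithinAt (fun t' => PhiA t' i j) ((A t * PhiA t) i j) (Icc (-1 : ℝ) 1) t)
    (hPhiA0 : PhiA (-1) = 1)
    (hPhiAinv : ∀ t ∈ Icc (-1 : ℝ) 1, IsUnit (PhiA t))
    (hB : ∀ i j : Fin d, ContinuousOn (fun t => B t i j) (Icc (-1 : ℝ) 1))
    (CA : ℝ)
    (hCA : ∀ s t : ℝ, -1 ≤ s → s ≤ t → t ≤ 1 → matNorm (PhiA t * (PhiA s)⁻¹) ≤ CA)
    {f : ℝ → Fin d → ℂ} (hf : ∀ i : Fin d, ContinuousOn (fun t => f t i) (Icc (-1 : ℝ) 1))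
    {t : ℝ} (ht : t ∈ Icc (-1:ℝ) 1) :
    vn (UopVec PhiA B f t) ≤ CA * vn (f 1) + CA * supNormMat B * ∫ s in (-1:ℝ)..1, vn (f s) := by
  have hCA0 : 0 ≤ CA := (matNorm_nonneg _).trans (hCA t t ht.1 le_rfl ht.2)
  have hPc : ∀ i j : Fin d, ContinuousOn (fun t => PhiA t i j) (Icc (-1 : ℝ) 1) :=
    fun i j t ht => (hPhiA t ht i j).continuousWithinAt
  have hh : ∀ j, ContinuousOn (fun s => ((PhiA s)⁻¹.mulVec ((B s).mulVec (f s))) j) (Icc (-1:ℝ) 1) :=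
    contOn_mulVec (contOn_inv hPc hPhiAinv) (contOn_mulVec hB hf)
  have hsub : uIcc (-1:ℝ) t ⊆ Icc (-1) 1 := by
    rw [uIcc_of_le ht.1]
    exact Icc_subset_Icc_right ht.2
  have hH := contOn_toLp hh
  have hHi : IntervalIntegrable (fun s => (WithLp.toLp 2 ((PhiA s)⁻¹.mulVec ((B s).mulVec (f s))) : EuclideanSpace ℂ (Fin d))) MeasureTheory.volume (-1) t :=
    (hH.mono hsub).intervalIntegrable
  let T := LinearMap.toContinuousLinearMap (Matrix.toEuclideanLin (PhiA t))
  have hint : (WithLp.toLp 2 (fun i => ∫ s in (-1 : ℝ)..t, ((PhiA s)⁻¹.mulVec ((B s).mulVec (f s))) i) : EuclideanSpace ℂ (Fin d))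
      = ∫ s in (-1:ℝ)..t, (WithLp.toLp 2 ((PhiA s)⁻¹.mulVec ((B s).mulVec (f s))) : EuclideanSpace ℂ (Fin d)) := by
    ext i
    exact ContinuousLinearMap.intervalIntegral_comp_comm (EuclideanSpace.proj i : EuclideanSpace ℂ (Fin d) →L[ℂ] ℂ) hHi
  have hvi : IntervalIntegrable (fun s => vn (f s)) MeasureTheory.volume (-1) 1 :=
    ContinuousOn.intervalIntegrable (by rw [uIcc_of_le (by norm_num)]; exact contOn_vn hf)
  have hvt : IntervalIntegrable (fun s => vn (f s)) MeasureTheory.volume (-1) t :=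
    ((contOn_vn hf).mono hsub).intervalIntegrable
  have h2 : vn ((PhiA t).mulVec (fun i => ∫ s in (-1 : ℝ)..t, ((PhiA s)⁻¹.mulVec ((B s).mulVec (f s))) i))
      ≤ CA * supNormMat B * ∫ s in (-1:ℝ)..1, vn (f s) := by
    have e1 : vn ((PhiA t).mulVec (fun i => ∫ s in (-1 : ℝ)..t, ((PhiA s)⁻¹.mulVec ((B s).mulVec (f s))) i))
        = ‖T (WithLp.toLp 2 (fun i => ∫ s in (-1 : ℝ)..t, ((PhiA s)⁻¹.mulVec ((B s).mulVec (f s))) i))‖ := rfl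
    rw [e1, hint, ← ContinuousLinearMap.intervalIntegral_comp_comm T hHi]
    calc _ ≤ ∫ s in (-1:ℝ)..t, CA * supNormMat B * vn (f s) := by
          refine intervalIntegral.norm_integral_le_of_norm_le ht.1 (Filter.Eventually.of_forall fun s hs => ?_) (hvt.const_mul _)
          have hs1 : s ∈ Icc (-1:ℝ) 1 := ⟨hs.1.le, hs.2.trans ht.2⟩
          change vn ((PhiA t).mulVec ((PhiA s)⁻¹.mulVec ((B s).mulVec (f s)))) ≤ _
          rw [Matrix.mulVec_mulVec]
          calc _ ≤ matNorm (PhiA t * (PhiA s)⁻¹) * vn ((B s).mulVec (f s)) := vn_mulVec _ _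
            _ ≤ CA * (supNormMat B * vn (f s)) := by
              refine mul_le_mul (hCA s t hs1.1 hs.2 ht.2) ?_ (vn_nonneg _) hCA0
              exact (vn_mulVec _ _).trans (mul_le_mul_of_nonneg_right (matNorm_le_sup hB hs1) (vn_nonneg _))
            _ = _ := by ring
      _ = CA * supNormMat B * ∫ s in (-1:ℝ)..t, vn (f s) := intervalIntegral.integral_const_mul _ _
      _ ≤ _ := by
          refine mul_le_mul_of_nonneg_left ?_ (mul_nonneg hCA0 (supNormMat_nonneg B))
          exact intervalIntegral.integral_mono_interval le_rfl ht.1 ht.2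
            (Filter.Eventually.of_forall fun s => vn_nonneg _) hvi
  have h1 : vn ((PhiA t).mulVec (f 1)) ≤ CA * vn (f 1) := by
    refine (vn_mulVec _ _).trans (mul_le_mul_of_nonneg_right ?_ (vn_nonneg _))
    have := hCA (-1) t le_rfl ht.1 ht.2
    simpa [hPhiA0] using this
  have e : UopVec PhiA B f t = (PhiA t).mulVec (f 1) + (PhiA t).mulVec (fun i => ∫ s in (-1 : ℝ)..t, ((PhiA s)⁻¹.mulVec ((B s).mulVec (f s))) i) := by
    rw [← Matrix.mulVec_add]; rfl
  rw [e]
  exact (vn_add _ _).trans (add_le_add h1 h2)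

end main

theorem final_alg (c C α β N D r : ℝ) (hc : 0 ≤ c) (hC : 0 ≤ C) (hβ : 0 ≤ β) (hr : 0 ≤ r) (hD : 1 ≤ D)
    (hN : 0 ≤ N) (P : ℝ) (hP : 0 ≤ P) (hr2 : r ^ 2 = P / 2) :
    2 * P * (C * (c * N) + C * β * (r * N)) ^ 2 + P * (α * (C * (c * N) + C * β * (r * N)) + β * (c * N)) ^ 2
     ≤ (Real.sqrt (2 * P * D) * (c * Real.sqrt (1 + α ^ 2) * C + β * Real.sqrt (c ^ 2 + P * Real.sqrt (1 + α ^ 2) ^ 2 * C ^ 2 / 2)) * N) ^ 2 := by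
  set a := Real.sqrt (1 + α ^ 2) with ha
  have ha0 : 0 ≤ a := Real.sqrt_nonneg _
  have ha2 : a ^ 2 = 1 + α ^ 2 := Real.sq_sqrt (by positivity)
  set R := Real.sqrt (c ^ 2 + P * a ^ 2 * C ^ 2 / 2) with hR
  have hR2 : R ^ 2 = c ^ 2 + (a * C * r) ^ 2 := by
    rw [hR, Real.sq_sqrt (by positivity), mul_pow, mul_pow, hr2]; ring
  have hRq : a * C * r ≤ R := by
    refine (pow_le_pow_iff_left₀ (by positivity) (Real.sqrt_nonneg _) two_ne_zero).1 ?_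
    rw [hR2]; nlinarith [sq_nonneg c]
  have hR0 : 0 ≤ R := Real.sqrt_nonneg _
  set M := C * (c * N) + C * β * (r * N) with hM
  rw [mul_pow, mul_pow, Real.sq_sqrt (by positivity)]
  have s1 : 2 * P * M ^ 2 + P * (α * M + β * (c * N)) ^ 2 ≤ 2 * P * ((1 + α ^ 2) * M ^ 2 + (β * c * N) ^ 2) := by
    nlinarith [mul_nonneg hP (sq_nonneg (α * M - β * (c * N)))]
  have s2 : (1 + α ^ 2) * M ^ 2 + (β * c * N) ^ 2 ≤ (c * a * C + β * R) ^ 2 * N ^ 2 := by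
    have e1 : (1 + α ^ 2) * M ^ 2 = ((c * a * C) ^ 2 + 2 * (c * a * C) * β * (a * C * r) + β ^ 2 * (a * C * r) ^ 2) * N ^ 2 := by
      rw [← ha2, hM]; ring
    have e2 : (c * a * C + β * R) ^ 2 * N ^ 2 = ((c * a * C) ^ 2 + 2 * (c * a * C) * β * R + β ^ 2 * (c ^ 2 + (a * C * r) ^ 2)) * N ^ 2 := by
      rw [← hR2]; ring
    rw [e1, e2]
    have : 2 * (c * a * C) * β * (a * C * r) ≤ 2 * (c * a * C) * β * R :=
      mul_le_mul_of_nonneg_left hRq (by positivity)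
    nlinarith [mul_le_mul_of_nonneg_right this (sq_nonneg N)]
  calc _ ≤ _ := s1
    _ ≤ 2 * P * ((c * a * C + β * R) ^ 2 * N ^ 2) := mul_le_mul_of_nonneg_left s2 (by positivity)
    _ ≤ 2 * P * D * ((c * a * C + β * R) ^ 2 * N ^ 2) := by
      refine mul_le_mul_of_nonneg_right ?_ (by positivity)
      nlinarith
    _ = _ := by ring

/-- norm bound for the monodromy operator of a DDE system on `𝐇¹`. -/
theorem monodromy_operator_system_h1_norm_bound
    (d : ℕ) (hd : 1 ≤ d)
    (A B : ℝ → Matrix (Fin d) (Fin d) ℂ)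
    (hA : ∀ i j : Fin d, ContinuousOn (fun t => A t i j) (Icc (-1 : ℝ) 1))
    (hB : ∀ i j : Fin d, ContinuousOn (fun t => B t i j) (Icc (-1 : ℝ) 1))
    (PhiA : ℝ → Matrix (Fin d) (Fin d) ℂ)
    (hPhiA : ∀ t ∈ Icc (-1 : ℝ) 1, ∀ i j : Fin d,
      HasDerivWithinAt (fun t' => PhiA t' i j) ((A t * PhiA t) i j) (Icc (-1 : ℝ) 1) t)
    (hPhiA0 : PhiA (-1) = 1)
    (hPhiAinv : ∀ t ∈ Icc (-1 : ℝ) 1, IsUnit (PhiA t))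
    (CA : ℝ)
    (hCA : ∀ s t : ℝ, -1 ≤ s → s ≤ t → t ≤ 1 → matNorm (PhiA t * (PhiA s)⁻¹) ≤ CA)
    (aconst c : ℝ)
    (ha : aconst = Real.sqrt (1 + supNormMat A ^ 2)) (hc : c = 0.9062) :
    ∀ f : ℝ → Fin d → ℂ,
      (∀ i : Fin d, ContinuousOn (fun t => f t i) (Icc (-1 : ℝ) 1)) →
      Summable (fun k : ℕ => ((1 : ℝ) + k) ^ 2 * ∑ i : Fin d, ‖chebCoeff (fun t => f t i) k‖ ^ 2) →
      Summable (fun k : ℕ => ((1 : ℝ) + k) ^ 2 *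
        ∑ i : Fin d, ‖chebCoeff (fun t => UopVec PhiA B f t i) k‖ ^ 2)
      ∧ Real.sqrt (h1NormVecSq (UopVec PhiA B f))
          ≤ Real.sqrt (2 * Real.pi * d)
            * (c * aconst * CA
              + supNormMat B * Real.sqrt (c ^ 2 + Real.pi * aconst ^ 2 * CA ^ 2 / 2))
            * Real.sqrt (h1NormVecSq f) := by
  intro f hf hs
  subst ha hc
  have hpi := Real.pi_pos
  have hd1 : (1:ℝ) ≤ d := by exact_mod_cast hd
  have hCA0 : 0 ≤ CA := (matNorm_nonneg _).trans (hCA (-1) (-1) le_rfl le_rfl (by norm_num))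
  set N := Real.sqrt (h1NormVecSq f) with hN
  have hN0 : 0 ≤ N := Real.sqrt_nonneg _
  have hderiv := fun (t : ℝ) (ht : t ∈ Icc (-1:ℝ) 1) (i : Fin d) =>
    U_deriv hPhiA hPhiAinv hB hf ht i
  have hUc : ∀ i, ContinuousOn (fun t => UopVec PhiA B f t i) (Icc (-1) 1) :=
    fun i t ht => (hderiv t ht i).continuousWithinAt
  set G' : ℝ → Fin d → ℂ := fun t => (A t).mulVec (UopVec PhiA B f t) + (B t).mulVec (f t) with hG'
  have hG'c : ∀ i, ContinuousOn (fun t => G' t i) (Icc (-1) 1) := fun i =>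
    (contOn_mulVec hA hUc i).add (contOn_mulVec hB hf i)
  have hup := fun i => h1_upper (fun t => UopVec PhiA B f t i) (fun t => G' t i)
    (fun t ht => hderiv t ht i) (hG'c i)
  have hsum := hasSum_vec (fun i => (hup i).1)
  refine ⟨hsum.summable, ?_⟩
  set M := CA * (0.9062 * N) + CA * supNormMat B * (Real.sqrt (Real.pi / 2) * N) with hM
  have hβ := supNormMat_nonneg B
  have hα := supNormMat_nonneg A
  have hUb : ∀ t ∈ Icc (-1:ℝ) 1, vn (UopVec PhiA B f t) ≤ M := by
    intro t ht
    refine (U_bound hPhiA hPhiA0 hPhiAinv hB CA hCA hf ht).trans ?_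
    exact add_le_add (mul_le_mul_of_nonneg_left (sup_vec hf hs (by norm_num)) hCA0)
      (mul_le_mul_of_nonneg_left (l1_vec hf hs) (mul_nonneg hCA0 hβ))
  have hGb : ∀ t ∈ Icc (-1:ℝ) 1, vn (G' t) ≤ supNormMat A * M + supNormMat B * (0.9062 * N) := by
    intro t ht
    refine (vn_add _ _).trans (add_le_add ?_ ?_)
    · exact (vn_mulVec _ _).trans (mul_le_mul (matNorm_le_sup hA ht) (hUb t ht) (vn_nonneg _) hα)
    · exact (vn_mulVec _ _).trans (mul_le_mul (matNorm_le_sup hB ht) (sup_vec hf hs ht) (vn_nonneg _) hβ)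
  set K := supNormMat A * M + supNormMat B * (0.9062 * N) with hK
  have hbound : h1NormVecSq (UopVec PhiA B f) ≤ 2 * Real.pi * M ^ 2 + Real.pi * K ^ 2 := by
    have hci : ∀ i, Continuous fun θ : ℝ => ‖UopVec PhiA B f (Real.cos θ) i‖ ^ 2 + Real.sin θ ^ 2 * ‖G' (Real.cos θ) i‖ ^ 2 :=
      fun i => ((cont_cos (hUc i)).norm.pow 2).add
        ((Real.continuous_sin.pow 2).mul ((cont_cos (hG'c i)).norm.pow 2))
    rw [h1NormVecSq, hsum.tsum_eq]
    refine (Finset.sum_le_sum fun i _ => (hup i).2).trans ?_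
    rw [← intervalIntegral.integral_finsetSum fun i _ => (hci i).intervalIntegrable _ _]
    have hsin : ∫ θ in (-Real.pi)..Real.pi, Real.sin θ ^ 2 = Real.pi := by
      rw [integral_sin_sq]; simp
    have e : ∫ θ in (-Real.pi)..Real.pi, (M ^ 2 + Real.sin θ ^ 2 * K ^ 2) = 2 * Real.pi * M ^ 2 + Real.pi * K ^ 2 := by
      rw [intervalIntegral.integral_add, intervalIntegral.integral_mul_const, hsin, intervalIntegral.integral_const, smul_eq_mul]
      · ring
      all_goals apply Continuous.intervalIntegrable; fun_prop
    rw [← e]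
    refine intervalIntegral.integral_mono_on (by linarith) ?_ ?_ ?_
    · exact (continuous_finsetSum _ fun i _ => hci i).intervalIntegrable _ _
    · apply Continuous.intervalIntegrable; fun_prop
    · intro θ _
      have hθ : Real.cos θ ∈ Icc (-1:ℝ) 1 := ⟨Real.neg_one_le_cos θ, Real.cos_le_one θ⟩
      rw [Finset.sum_add_distrib, ← Finset.mul_sum, ← vn_sq, ← vn_sq]
      have h1 := pow_le_pow_left₀ (vn_nonneg _) (hUb _ hθ) 2
      have h2 := pow_le_pow_left₀ (vn_nonneg _) (hGb _ hθ) 2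
      exact add_le_add h1 (mul_le_mul_of_nonneg_left h2 (sq_nonneg _))
  refine Real.sqrt_le_iff.2 ⟨by positivity, hbound.trans ?_⟩
  exact final_alg 0.9062 CA (supNormMat A) (supNormMat B) N d (Real.sqrt (Real.pi / 2)) (by norm_num) hCA0 hβ
    (Real.sqrt_nonneg _) hd1 hN0 Real.pi hpi.le (Real.sq_sqrt (by positivity))
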